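/- Suppose p ∈ ℤ^n and q ∈ ℤ^m have positive nonincreasing entries with Σ_j p_j = Σ_i q_i = N. Then trun_{P,Q} T is approximately scalable to doubly stochastic by invertible N×N matrices (i.e., for every ε > 0 there exist invertible g, h ∈ Mat_N(ℂ) with ‖g† (trun_{P,Q} T)(h h†) g − I_N‖ ≤ ε and ‖h† (trun_{P,Q} T)*(g g†) h − I_N‖ ≤ ε) if and only if T is approximately scalable by invertible upper-triangular matrices to (I_n → Q, I_m → P) (i.e., for every ε > 0 there exist invertible upper-triangular g ∈ Mat_m(ℂ), h ∈ Mat_n(ℂ) with ‖g† T(h h†) g − Q‖ ≤ ε and ‖h† T*(g g†) h − P‖ ≤ ε). -/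

import Mathlib

open Matrix BigOperators

noncomputable section

/-- `η_j` : the projection onto the first `j` coordinates, as a `j × k` matrix. -/
def proj (j k : ℕ) : Matrix (Fin j) (Fin k) ℂ :=
  Matrix.of fun i l => if (i : ℕ) = (l : ℕ) then 1 else 0

/-- `Δa_j = a_j − a_{j+1}`, with the convention `a_{k+1} = 0`. -/
def delta {k : ℕ} (a : Fin k → ℝ) (j : Fin k) : ℝ :=
  a j - (if h : (j : ℕ) + 1 < k then a ⟨(j : ℕ) + 1, h⟩ else 0)

/-- Integer version of `delta`. -/
def deltaNat {k : ℕ} (a : Fin k → ℕ) (j : Fin k) : ℕ :=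
  a j - (if h : (j : ℕ) + 1 < k then a ⟨(j : ℕ) + 1, h⟩ else 0)

/-- The relative determinant `det(diag a, X) = ∏_j det(η_j X η_j†)^{Δa_j}` (real exponents,
with the convention `0 ^ 0 = 1`). -/
def relDet {k : ℕ} (a : Fin k → ℝ) (X : Matrix (Fin k) (Fin k) ℂ) : ℝ :=
  ∏ j : Fin k,
    ((proj ((j : ℕ) + 1) k * X * (proj ((j : ℕ) + 1) k)ᴴ).det.re) ^ (delta a j)

/-- Complex relative determinant for integral weights. -/
def relDetC {k : ℕ} (a : Fin k → ℕ) (X : Matrix (Fin k) (Fin k) ℂ) : ℂ :=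
  ∏ j : Fin k,
    ((proj ((j : ℕ) + 1) k * X * (proj ((j : ℕ) + 1) k)ᴴ).det) ^ (deltaNat a j)

/-- The completely positive map `T(X) = Σ A_i X A_i†` with Kraus operators `A i`. -/
def cpMap {ι κ : Type*} [Fintype ι] {r : ℕ} (A : Fin r → Matrix κ ι ℂ)
    (X : Matrix ι ι ℂ) : Matrix κ κ ℂ :=
  ∑ i, A i * X * (A i)ᴴ

/-- The dual completely positive map `T*(Y) = Σ A_i† Y A_i`. -/
def cpDual {ι κ : Type*} [Fintype κ] {r : ℕ} (A : Fin r → Matrix κ ι ℂ)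
    (Y : Matrix κ κ ℂ) : Matrix ι ι ℂ :=
  ∑ i, (A i)ᴴ * Y * A i

/-- Frobenius norm `‖A‖ = √(Tr A Aᴴ)`. -/
def frob {ι κ : Type*} [Fintype ι] [Fintype κ] (A : Matrix ι κ ℂ) : ℝ :=
  Real.sqrt (A * Aᴴ).trace.re

/-- Upper triangular predicate. -/
def UT {k : ℕ} (g : Matrix (Fin k) (Fin k) ℂ) : Prop :=
  ∀ i j : Fin k, j < i → g i j = 0

/-- Capacity with specified marginals:
`cap(T,P,Q) = inf over invertible upper triangular h of det(Q, T(hPh†)) / det(P, h†h)`. -/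
def cap {n m r : ℕ} (A : Fin r → Matrix (Fin m) (Fin n) ℂ)
    (p : Fin n → ℝ) (q : Fin m → ℝ) : ℝ :=
  sInf { x : ℝ | ∃ h : Matrix (Fin n) (Fin n) ℂ, IsUnit h.det ∧ UT h ∧
    x = relDet q (cpMap A (h * Matrix.diagonal (fun j => (p j : ℂ)) * hᴴ)) /
        relDet p (hᴴ * h) }

/-- Span of the first `i` standard basis vectors of `ℂ^k`. -/
def coordSub (k i : ℕ) : Submodule ℂ (Fin k → ℂ) where
  carrier := { x | ∀ l : Fin k, i ≤ (l : ℕ) → x l = 0 }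
  add_mem' := by intro a b ha hb l hl; simp [ha l hl, hb l hl]
  zero_mem' := by intro l _; rfl
  smul_mem' := by intro c x hx l hl; simp [hx l hl]

/-- `(L, R)` is a `T`-independent pair: `A_i R ⊥ L` for all `i`. -/
def TIndep {n m r : ℕ} (A : Fin r → Matrix (Fin m) (Fin n) ℂ)
    (L : Submodule ℂ (Fin m → ℂ)) (R : Submodule ℂ (Fin n → ℂ)) : Prop :=
  ∀ i : Fin r, ∀ x ∈ R, ∀ y ∈ L, star y ⬝ᵥ (A i).mulVec x = 0

/-- `(P,Q)`-rank-nondecreasingness. -/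
def rankNonDec {n m r : ℕ} (A : Fin r → Matrix (Fin m) (Fin n) ℂ)
    (p : Fin n → ℝ) (q : Fin m → ℝ) : Prop :=
  ∀ L : Submodule ℂ (Fin m → ℂ), ∀ R : Submodule ℂ (Fin n → ℂ), TIndep A L R →
    (∑ i : Fin m, delta q i * (Module.finrank ℂ ↥(coordSub m ((i : ℕ) + 1) ⊓ L) : ℝ)) +
      (∑ j : Fin n, delta p j * (Module.finrank ℂ ↥(coordSub n ((j : ℕ) + 1) ⊓ R) : ℝ))
      ≤ ∑ j, p j

/-- `λ'_{i+1}`: number of parts of `lam` that are `> i` (0-indexed conjugate partition). -/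
def conj' {k : ℕ} (lam : Fin k → ℕ) (i : ℕ) : ℕ :=
  (Finset.univ.filter fun j : Fin k => i < lam j).card

lemma conj'_le {k : ℕ} (lam : Fin k → ℕ) (i : ℕ) : conj' lam i ≤ k := by
  classical
  calc conj' lam i ≤ Finset.univ.card := Finset.card_filter_le _ _
    _ = k := by simp

/-- Index set for the blocks of `G_λ`; it has cardinality `Σ_i λ'_i = Σ_j λ_j`. -/
abbrev lamIdx {k : ℕ} (lam : Fin k → ℕ) : Type :=
  Σ i : Fin (Finset.univ.sup lam), Fin (conj' lam (i : ℕ))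

/-- The gadget map `G_λ(X) = ⊕_{i=1}^{λ_1} η_{λ'_i} X η_{λ'_i}†`. -/
def Gmap {k : ℕ} (lam : Fin k → ℕ) (X : Matrix (Fin k) (Fin k) ℂ) :
    Matrix (lamIdx lam) (lamIdx lam) ℂ := fun s t =>
  if s.1 = t.1 then
    X (Fin.castLE (conj'_le lam (s.1 : ℕ)) s.2) (Fin.castLE (conj'_le lam (t.1 : ℕ)) t.2)
  else 0

/-- The adjoint `G_λ*` of the gadget map with respect to the trace inner product. -/
def GmapAdj {k : ℕ} (lam : Fin k → ℕ) (Y : Matrix (lamIdx lam) (lamIdx lam) ℂ) :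
    Matrix (Fin k) (Fin k) ℂ := fun a b =>
  ∑ i : Fin (Finset.univ.sup lam),
    if h : (a : ℕ) < conj' lam (i : ℕ) ∧ (b : ℕ) < conj' lam (i : ℕ) then
      Y ⟨i, ⟨(a : ℕ), h.1⟩⟩ ⟨i, ⟨(b : ℕ), h.2⟩⟩
    else 0

/-- The reduction `trun_{P,Q} T = G_q ∘ T ∘ G_p*`. -/
def trun {n m r : ℕ} (A : Fin r → Matrix (Fin m) (Fin n) ℂ) (p : Fin n → ℕ) (q : Fin m → ℕ)
    (X : Matrix (lamIdx p) (lamIdx p) ℂ) : Matrix (lamIdx q) (lamIdx q) ℂ :=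
  Gmap q (cpMap A (GmapAdj p X))

/-- The dual of the reduction: `(trun_{P,Q} T)* = G_p ∘ T* ∘ G_q*`. -/
def trunDual {n m r : ℕ} (A : Fin r → Matrix (Fin m) (Fin n) ℂ) (p : Fin n → ℕ) (q : Fin m → ℕ)
    (Y : Matrix (lamIdx q) (lamIdx q) ℂ) : Matrix (lamIdx p) (lamIdx p) ℂ :=
  Gmap p (cpDual A (GmapAdj q Y))

/-- Shannon entropy with convention `0 · log 0 = 0` (note `Real.log 0 = 0`). -/
def entropy {k : ℕ} (p : Fin k → ℝ) : ℝ := -∑ j, p j * Real.log (p j)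

/-- The distance-to-target measure `ds_{P,Q}(T)`. -/
def ds {n m r : ℕ} (A : Fin r → Matrix (Fin m) (Fin n) ℂ)
    (p : Fin n → ℝ) (q : Fin m → ℝ) : ℝ :=
  (∑ j : Fin n, delta p j *
      (frob (proj ((j : ℕ) + 1) n *
        (cpDual A (Matrix.diagonal fun i => (q i : ℂ)) - 1) * (proj ((j : ℕ) + 1) n)ᴴ)) ^ 2) +
    ∑ i : Fin m, delta q i *
      (frob (proj ((i : ℕ) + 1) m *
        (cpMap A (Matrix.diagonal fun j => (p j : ℂ)) - 1) * (proj ((i : ℕ) + 1) m)ᴴ)) ^ 2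

/-- `(u_1,…,u_n)` can be approximately put in `Q`-isotropic position with respect to `p`. -/
def approxIso {m n : ℕ} (u : Fin n → Fin m → ℂ) (p : Fin n → ℝ)
    (Q : Matrix (Fin m) (Fin m) ℂ) : Prop :=
  ∀ ε : ℝ, 0 < ε → ∃ B : Matrix (Fin m) (Fin m) ℂ, IsUnit B.det ∧
    frob ((∑ i : Fin n,
      (((p i / ∑ a, Complex.normSq (B.mulVec (u i) a)) : ℝ) : ℂ) •
        Matrix.vecMulVec (B.mulVec (u i)) (star (B.mulVec (u i)))) - Q) ≤ ε


section PositiveSemidefinite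

open scoped ComplexOrder MatrixOrder

variable {ι κ : Type*}

/-- Multiplicative closeness in the Loewner order: `X ≤ c Y` and `Y ≤ c X`. -/
def Near (c : ℝ) (X Y : Matrix ι ι ℂ) : Prop :=
  (c • Y - X).PosSemidef ∧ (c • X - Y).PosSemidef

lemma Near.symm {c : ℝ} {X Y : Matrix ι ι ℂ} (h : Near c X Y) : Near c Y X := ⟨h.2, h.1⟩

lemma posSemidef_trans {c d : ℝ} (hc : 0 ≤ c) {X Y Z : Matrix ι ι ℂ}
    (h1 : (c • Y - X).PosSemidef) (h2 : (d • Z - Y).PosSemidef) :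
    ((c * d) • Z - X).PosSemidef := by
  have := h1.add (h2.smul hc)
  rwa [smul_sub, smul_smul, sub_add_sub_cancel'] at this

lemma Near.trans {c d : ℝ} (hc : 0 ≤ c) (hd : 0 ≤ d) {X Y Z : Matrix ι ι ℂ} (h1 : Near c X Y)
    (h2 : Near d Y Z) : Near (c * d) X Z :=
  ⟨posSemidef_trans hc h1.1 h2.1, mul_comm d c ▸ posSemidef_trans hd h2.2 h1.2⟩

lemma Near.posDef {c : ℝ} (hc : 0 < c) {X Y : Matrix ι ι ℂ} (hX : X.PosDef) (h : Near c X Y) :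
    Y.PosDef := by
  have := (hX.add_posSemidef h.1).smul (inv_pos.2 hc)
  rwa [add_sub_cancel, smul_smul, inv_mul_cancel₀ hc.ne', one_smul] at this

variable [Fintype ι] [Fintype κ]

lemma frob_nonneg (A : Matrix ι κ ℂ) : 0 ≤ frob A := Real.sqrt_nonneg _

lemma frob_sq (A : Matrix ι κ ℂ) : frob A ^ 2 = (A * Aᴴ).trace.re := by
  refine Real.sq_sqrt ?_
  exact (Complex.le_def.1 (posSemidef_self_mul_conjTranspose A).trace_nonneg).1

lemma frob_sq_eq_sum (A : Matrix ι κ ℂ) : frob A ^ 2 = ∑ x : ι × κ, ‖A x.1 x.2‖ ^ 2 := by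
  rw [frob_sq, Fintype.sum_prod_type, trace, Complex.re_sum]
  refine Finset.sum_congr rfl fun i _ => ?_
  rw [diag_apply, mul_apply, Complex.re_sum]
  refine Finset.sum_congr rfl fun j _ => ?_
  rw [conjTranspose_apply, Complex.star_def, Complex.mul_conj, Complex.ofReal_re,
    Complex.normSq_eq_norm_sq]

lemma trace_mul_re_nonneg {A B : Matrix ι ι ℂ} (hA : A.PosSemidef) (hB : B.PosSemidef) :
    0 ≤ (A * B).trace.re := by
  classical
  obtain ⟨R, hR⟩ := CStarAlgebra.nonneg_iff_eq_star_mul_self.1 (Matrix.nonneg_iff_posSemidef.2 hB)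
  have h := (hA.mul_mul_conjTranspose_same R).trace_nonneg
  rw [trace_mul_comm, ← star_eq_conjTranspose, ← Matrix.mul_assoc, ← hR, trace_mul_comm] at h
  exact (Complex.le_def.1 h).1

lemma norm_star_dotProduct_mulVec_le (E : Matrix ι ι ℂ) (x : ι → ℂ) :
    ‖star x ⬝ᵥ (E *ᵥ x)‖ ≤ frob E * ∑ i, ‖x i‖ ^ 2 := by
  have h1 : ‖star x ⬝ᵥ (E *ᵥ x)‖ ≤ ∑ a : ι × ι, ‖E a.1 a.2‖ * (‖x a.1‖ * ‖x a.2‖) := by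
    rw [Fintype.sum_prod_type, dotProduct]
    refine (norm_sum_le _ _).trans (Finset.sum_le_sum fun i _ => ?_)
    rw [norm_mul, mulVec, dotProduct, Pi.star_apply, norm_star]
    refine (mul_le_mul_of_nonneg_left (norm_sum_le _ _) (norm_nonneg _)).trans ?_
    rw [Finset.mul_sum]
    refine Finset.sum_le_sum fun j _ => le_of_eq ?_
    rw [norm_mul]; ring
  have h2 := Finset.sum_mul_sq_le_sq_mul_sq Finset.univ
    (fun a : ι × ι => ‖E a.1 a.2‖) (fun a => ‖x a.1‖ * ‖x a.2‖)
  have h3 : ∑ a : ι × ι, (‖x a.1‖ * ‖x a.2‖) ^ 2 = (∑ i, ‖x i‖ ^ 2) ^ 2 := by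
    rw [sq, Finset.sum_mul_sum, Fintype.sum_prod_type]
    exact Finset.sum_congr rfl fun i _ => Finset.sum_congr rfl fun j _ => mul_pow _ _ _
  rw [← frob_sq_eq_sum, h3, ← mul_pow] at h2
  exact h1.trans ((sq_le_sq₀ (h1.trans' (norm_nonneg _))
    (mul_nonneg (frob_nonneg _) (Finset.sum_nonneg fun i _ => sq_nonneg _))).1 h2)

/-- Hermitian matrices of Frobenius norm at most `δ` are bounded by `δ` in the Loewner order. -/
lemma posSemidef_of_frob_le [DecidableEq ι] {E : Matrix ι ι ℂ} (hE : E.IsHermitian) {δ : ℝ}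
    (h : frob E ≤ δ) : (δ • (1 : Matrix ι ι ℂ) - E).PosSemidef := by
  have hH : (δ • (1 : Matrix ι ι ℂ)).IsHermitian := by
    simp [IsHermitian, conjTranspose_smul]
  refine .of_dotProduct_mulVec_nonneg (hH.sub hE) fun x => ?_
  have him : (star x ⬝ᵥ (E *ᵥ x)).im = 0 := by
    simpa using hE.im_star_dotProduct_mulVec_self x
  have hb := norm_star_dotProduct_mulVec_le E x
  have hx : star x ⬝ᵥ x = ((∑ i, ‖x i‖ ^ 2 : ℝ) : ℂ) := by
    simp [dotProduct, ← Complex.normSq_eq_norm_sq, Complex.normSq_eq_conj_mul_self]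
  have hS : 0 ≤ ∑ i, ‖x i‖ ^ 2 := Finset.sum_nonneg fun i _ => sq_nonneg _
  rw [sub_mulVec, dotProduct_sub, smul_mulVec, one_mulVec, dotProduct_smul, hx, Complex.le_def]
  have hre := (Complex.re_le_norm (star x ⬝ᵥ (E *ᵥ x))).trans hb
  have := mul_le_mul_of_nonneg_right h hS
  constructor
  · simp only [Complex.zero_re, Complex.sub_re, Complex.real_smul, Complex.mul_re,
      Complex.ofReal_re, Complex.ofReal_im]
    linarith
  · simp only [Complex.zero_im, Complex.sub_im, Complex.real_smul, Complex.mul_im,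
      Complex.ofReal_re, Complex.ofReal_im, him]
    ring

lemma frob_neg (A : Matrix ι κ ℂ) : frob (-A) = frob A := by
  simp [frob]

lemma frob_le_of_posSemidef {S H : Matrix ι ι ℂ} {δ : ℝ} (hδ : 0 ≤ δ) (hS : S.IsHermitian)
    (h1 : (δ • S - H).PosSemidef) (h2 : (δ • S + H).PosSemidef) : frob H ≤ δ * frob S := by
  have hSH : (δ • S).IsHermitian := by
    rw [IsHermitian, conjTranspose_smul, hS.eq, star_trivial]
  have hH : H.IsHermitian := by
    simpa using h2.isHermitian.sub hSH
  have h := trace_mul_re_nonneg h1 h2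
  have h4 : ((δ • S - H) * (δ • S + H)).trace.re = δ ^ 2 * (S * S).trace.re - (H * H).trace.re := by
    simp only [Matrix.sub_mul, Matrix.mul_add, trace_sub, trace_add, smul_mul_assoc, mul_smul_comm,
      trace_smul, Complex.sub_re, Complex.add_re, Complex.real_smul, Complex.mul_re,
      Complex.ofReal_re, Complex.ofReal_im, trace_mul_comm S H]
    ring
  have h5 : frob H ^ 2 ≤ (δ * frob S) ^ 2 := by
    rw [mul_pow, frob_sq, frob_sq, hH.eq, hS.eq]
    linarith
  exact (sq_le_sq₀ (frob_nonneg _) (mul_nonneg hδ (frob_nonneg _))).1 h5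

lemma Near.conj {c : ℝ} {X Y : Matrix ι ι ℂ} (h : Near c X Y) (B : Matrix κ ι ℂ) :
    Near c (B * X * Bᴴ) (B * Y * Bᴴ) := by
  have key : ∀ U V : Matrix ι ι ℂ, (c • V - U).PosSemidef →
      (c • (B * V * Bᴴ) - B * U * Bᴴ).PosSemidef := fun U V hUV => by
    have := hUV.mul_mul_conjTranspose_same B
    rwa [Matrix.mul_sub, Matrix.sub_mul, Matrix.mul_smul, Matrix.smul_mul] at this
  exact ⟨key _ _ h.1, key _ _ h.2⟩

lemma posSemidef_inv_sub_inv [DecidableEq ι] {c : ℝ} (hc : 0 < c) {X Y : Matrix ι ι ℂ}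
    (hX : X.PosDef) (hY : Y.PosDef) (h : (c • Y - X).PosSemidef) :
    (c • X⁻¹ - Y⁻¹).PosSemidef := by
  have hXu := (isUnit_iff_isUnit_det _).1 hX.isUnit
  have hYu := (isUnit_iff_isUnit_det _).1 hY.isUnit
  have hYi : (Y⁻¹)ᴴ = Y⁻¹ := hY.inv.isHermitian.eq
  have hXi : (X⁻¹)ᴴ = X⁻¹ := hX.inv.isHermitian.eq
  have h1 := (h.mul_mul_conjTranspose_same Y⁻¹).smul (inv_nonneg.2 hc.le)
  have h2 := (hX.posSemidef.mul_mul_conjTranspose_same (c • X⁻¹ - Y⁻¹)).smul (inv_nonneg.2 hc.le)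
  convert h1.add h2 using 1
  simp only [conjTranspose_sub, conjTranspose_smul, star_trivial, hYi, hXi, Matrix.sub_mul,
    Matrix.mul_sub, Matrix.smul_mul, Matrix.mul_smul, nonsing_inv_mul _ hXu, nonsing_inv_mul _ hYu,
    mul_nonsing_inv_cancel_right _ _ hXu, Matrix.one_mul, smul_sub, smul_smul,
    inv_mul_cancel₀ hc.ne', one_smul]
  have : c⁻¹ * (c * c) = c := by field_simp
  simp only [this]
  abel

lemma Near.inv [DecidableEq ι] {c : ℝ} (hc : 0 < c) {X Y : Matrix ι ι ℂ}
    (hX : X.PosDef) (hY : Y.PosDef) (h : Near c X Y) : Near c X⁻¹ Y⁻¹ :=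
  ⟨posSemidef_inv_sub_inv hc hY hX h.2, posSemidef_inv_sub_inv hc hX hY h.1⟩

lemma near_one_of_frob_le [DecidableEq ι] {M : Matrix ι ι ℂ} (hM : M.IsHermitian) {t : ℝ}
    (ht : 0 < t) (h : frob (M - 1) ≤ t / (1 + t)) : Near (1 + t) M 1 := by
  have hE : (M - 1).IsHermitian := hM.sub isHermitian_one
  have h1 := posSemidef_of_frob_le hE h
  have h2 := posSemidef_of_frob_le hE.neg ((frob_neg _).trans_le h)
  have ht' : 0 < 1 + t := by linarith
  constructor
  · have h3 : ((t - t / (1 + t)) • (1 : Matrix ι ι ℂ)).PosSemidef :=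
      PosSemidef.one.smul (sub_nonneg.2 (div_le_self ht.le (by linarith)))
    convert h1.add h3 using 1
    simp only [sub_smul, add_smul, one_smul]
    abel
  · convert h2.smul ht'.le using 1
    rw [smul_sub, smul_smul, mul_div_cancel₀ _ ht'.ne', smul_neg, smul_sub]
    simp only [add_smul, one_smul]
    abel

lemma frob_sub_le_of_near {M S : Matrix ι ι ℂ} {c : ℝ} (hc : 1 ≤ c) (hS : S.PosSemidef)
    (h : Near c M S) : frob (M - S) ≤ (c - 1) * frob S := by
  have hc0 : 0 < c := by linarith
  refine frob_le_of_posSemidef (by linarith) hS.isHermitian ?_ ?_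
  · convert h.1 using 1
    rw [sub_smul, one_smul]; abel
  · have h3 : ((c⁻¹ + c - 2) • S).PosSemidef := hS.smul (by
      have : c⁻¹ + c - 2 = (c - 1) ^ 2 / c := by field_simp; ring
      rw [this]; positivity)
    convert (h.2.smul (inv_nonneg.2 hc0.le)).add h3 using 1
    rw [smul_sub, smul_smul, inv_mul_cancel₀ hc0.ne']
    simp only [sub_smul, add_smul, one_smul, two_smul]
    abel

lemma exists_upperTriangular_conj_eq_one {k : ℕ} {Z : Matrix (Fin k) (Fin k) ℂ} (hZ : Z.PosDef) :
    ∃ u : Matrix (Fin k) (Fin k) ℂ, UT u ∧ IsUnit u.det ∧ uᴴ * Z * u = 1 := by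
  have hD : (LDL.diag hZ).PosDef := by
    rw [LDL.diag_eq_lowerInv_conj]
    refine hZ.mul_mul_conjTranspose_same ?_
    exact Matrix.vecMul_injective_iff_isUnit.2 (isUnit_of_invertible _)
  have hd : ∀ i, 0 < LDL.diagEntries hZ i := posDef_diagonal_iff.1 hD
  set s : Fin k → ℂ := fun i => (((Real.sqrt (LDL.diagEntries hZ i).re)⁻¹ : ℝ) : ℂ) with hs
  set u := (LDL.lowerInv hZ)ᴴ * diagonal s with hu
  have huZ : uᴴ * Z * u = 1 := by
    have : uᴴ * Z * u = diagonal (star s) * LDL.diag hZ * diagonal s := by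
      rw [LDL.diag_eq_lowerInv_conj, hu, conjTranspose_mul, conjTranspose_conjTranspose,
        diagonal_conjTranspose]
      simp only [Matrix.mul_assoc]
    rw [this, LDL.diag, diagonal_mul_diagonal, diagonal_mul_diagonal, ← diagonal_one]
    congr 1
    ext i
    obtain ⟨hr, hi⟩ := Complex.lt_def.1 (hd i)
    have hdi : LDL.diagEntries hZ i = ((LDL.diagEntries hZ i).re : ℂ) :=
      Complex.ext rfl (by simpa using hi.symm)
    have hr' : 0 < (LDL.diagEntries hZ i).re := hr
    rw [hdi]
    simp only [hs, Pi.star_apply, Complex.star_def, Complex.conj_ofReal, ← Complex.ofReal_mul]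
    norm_cast
    have := Real.mul_self_sqrt hr'.le
    field_simp
    rw [sq, this]
  refine ⟨u, fun i j hij => ?_, ?_, huZ⟩
  · rw [hu, mul_diagonal, conjTranspose_apply, LDL.lowerInv_triangular hZ hij, star_zero, zero_mul]
  · have := congrArg det huZ
    rw [det_mul, det_one] at this
    exact IsUnit.of_mul_eq_one_right _ this

end PositiveSemidefinite
section CompletelyPositive

open scoped ComplexOrder

variable {ι κ : Type*} [Fintype ι] {r : ℕ}

lemma cpDual_eq_cpMap (A : Fin r → Matrix ι κ ℂ) (Y : Matrix ι ι ℂ) :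
    cpDual A Y = cpMap (fun i => (A i)ᴴ) Y := by
  simp [cpDual, cpMap]

lemma cpMap_add (A : Fin r → Matrix κ ι ℂ) (X Y : Matrix ι ι ℂ) :
    cpMap A (X + Y) = cpMap A X + cpMap A Y := by
  simp [cpMap, Matrix.mul_add, Matrix.add_mul, Finset.sum_add_distrib]

lemma cpMap_sub (A : Fin r → Matrix κ ι ℂ) (X Y : Matrix ι ι ℂ) :
    cpMap A (X - Y) = cpMap A X - cpMap A Y := by
  simp [cpMap, Matrix.mul_sub, Matrix.sub_mul, Finset.sum_sub_distrib]

lemma cpMap_smul (A : Fin r → Matrix κ ι ℂ) (c : ℝ) (X : Matrix ι ι ℂ) :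
    cpMap A (c • X) = c • cpMap A X := by
  simp [cpMap, Finset.smul_sum]

lemma cpMap_posSemidef [Finite κ] (A : Fin r → Matrix κ ι ℂ) {X : Matrix ι ι ℂ}
    (hX : X.PosSemidef) : (cpMap A X).PosSemidef :=
  posSemidef_sum _ fun i _ => hX.mul_mul_conjTranspose_same (A i)

lemma cpDual_posSemidef [Finite κ] (A : Fin r → Matrix ι κ ℂ) {X : Matrix ι ι ℂ}
    (hX : X.PosSemidef) : (cpDual A X).PosSemidef :=
  cpDual_eq_cpMap A X ▸ cpMap_posSemidef _ hX

lemma Near.cpMap [Finite κ] {c : ℝ} {X Y : Matrix ι ι ℂ} (h : Near c X Y)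
    (A : Fin r → Matrix κ ι ℂ) : Near c (cpMap A X) (cpMap A Y) := by
  constructor
  · rw [← cpMap_smul, ← cpMap_sub]
    exact cpMap_posSemidef A h.1
  · rw [← cpMap_smul, ← cpMap_sub]
    exact cpMap_posSemidef A h.2

lemma Near.cpDual [Finite κ] {c : ℝ} {X Y : Matrix ι ι ℂ} (h : Near c X Y)
    (A : Fin r → Matrix ι κ ℂ) : Near c (cpDual A X) (cpDual A Y) := by
  rw [cpDual_eq_cpMap, cpDual_eq_cpMap]
  exact h.cpMap _

lemma frob_cpMap_le [Fintype κ] [DecidableEq ι] (A : Fin r → Matrix κ ι ℂ) {E : Matrix ι ι ℂ}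
    (hE : E.IsHermitian) {δ : ℝ} (h : frob E ≤ δ) :
    frob (cpMap A E) ≤ δ * frob (cpMap A 1) := by
  refine frob_le_of_posSemidef ((frob_nonneg E).trans h)
    (cpMap_posSemidef A PosSemidef.one).isHermitian ?_ ?_
  · rw [← cpMap_smul, ← cpMap_sub]
    exact cpMap_posSemidef A (posSemidef_of_frob_le hE h)
  · rw [← cpMap_smul, ← cpMap_add]
    have := posSemidef_of_frob_le hE.neg ((frob_neg E).trans_le h)
    rw [sub_neg_eq_add] at this
    exact cpMap_posSemidef A this

end CompletelyPositive

section Gadget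

open scoped ComplexOrder

variable {k : ℕ}

/-- The Kraus operators of `Gmap`: the projection onto the first `λ'_i` coordinates, placed in the
`i`-th block. -/
def blockProj (lam : Fin k → ℕ) (i : Fin (Finset.univ.sup lam)) :
    Matrix (lamIdx lam) (Fin k) ℂ := fun s a =>
  if s.1 = i ∧ Fin.castLE (conj'_le lam (s.1 : ℕ)) s.2 = a then 1 else 0

lemma blockProj_mul_apply (lam : Fin k → ℕ) (i : Fin (Finset.univ.sup lam)) {β : Type*}
    (X : Matrix (Fin k) β ℂ) (s : lamIdx lam) (b : β) :
    (blockProj lam i * X) s b =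
      if s.1 = i then X (Fin.castLE (conj'_le lam (s.1 : ℕ)) s.2) b else 0 := by
  simp [mul_apply, blockProj, ite_and]

lemma mul_conjTranspose_blockProj_apply (lam : Fin k → ℕ) (i : Fin (Finset.univ.sup lam))
    {β : Type*} (X : Matrix β (Fin k) ℂ) (b : β) (t : lamIdx lam) :
    (X * (blockProj lam i)ᴴ) b t =
      if t.1 = i then X b (Fin.castLE (conj'_le lam (t.1 : ℕ)) t.2) else 0 := by
  simp [mul_apply, blockProj, ite_and, apply_ite star]

lemma conjTranspose_blockProj_mul_apply (lam : Fin k → ℕ) (i : Fin (Finset.univ.sup lam))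
    {β : Type*} (Y : Matrix (lamIdx lam) β ℂ) (a : Fin k) (b : β) :
    ((blockProj lam i)ᴴ * Y) a b =
      if h : (a : ℕ) < conj' lam (i : ℕ) then Y ⟨i, ⟨(a : ℕ), h⟩⟩ b else 0 := by
  rw [mul_apply]
  split_ifs with h
  · rw [Finset.sum_eq_single ⟨i, ⟨(a : ℕ), h⟩⟩]
    · simp [blockProj]
    · rintro ⟨j, d⟩ - hne
      have : ¬ (j = i ∧ Fin.castLE (conj'_le lam (j : ℕ)) d = a) := by
        rintro ⟨rfl, rfl⟩
        exact hne rfl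
      simp [blockProj, this]
    · simp
  · refine Finset.sum_eq_zero ?_
    rintro ⟨j, d⟩ -
    have : ¬ (j = i ∧ Fin.castLE (conj'_le lam (j : ℕ)) d = a) := by
      rintro ⟨rfl, rfl⟩
      exact h d.2
    simp [blockProj, this]

lemma mul_blockProj_apply (lam : Fin k → ℕ) (i : Fin (Finset.univ.sup lam))
    {β : Type*} (Y : Matrix β (lamIdx lam) ℂ) (b : β) (a : Fin k) :
    (Y * blockProj lam i) b a =
      if h : (a : ℕ) < conj' lam (i : ℕ) then Y b ⟨i, ⟨(a : ℕ), h⟩⟩ else 0 := by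
  have := congrArg star (conjTranspose_blockProj_mul_apply lam i Yᴴ a b)
  rw [← conjTranspose_mul, conjTranspose_apply, star_star] at this
  rw [this]
  split_ifs <;> simp

lemma Gmap_eq_cpMap (lam : Fin k → ℕ) (X : Matrix (Fin k) (Fin k) ℂ) :
    Gmap lam X = cpMap (blockProj lam) X := by
  ext s t
  simp only [Gmap, cpMap, Matrix.sum_apply, mul_conjTranspose_blockProj_apply, blockProj_mul_apply]
  by_cases h : s.1 = t.1
  · simp [h]
  · simp [h]

lemma GmapAdj_eq_cpDual (lam : Fin k → ℕ) (Y : Matrix (lamIdx lam) (lamIdx lam) ℂ) :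
    GmapAdj lam Y = cpDual (blockProj lam) Y := by
  ext a b
  simp only [GmapAdj, cpDual, Matrix.sum_apply, mul_blockProj_apply,
    conjTranspose_blockProj_mul_apply]
  refine Finset.sum_congr rfl fun i _ => ?_
  split_ifs <;> first | rfl | (exfalso; tauto)

/-- Upper triangular matrices preserve the flag of coordinate subspaces. -/
lemma conjTranspose_blockProj_mul_Gmap (lam : Fin k → ℕ) (i : Fin (Finset.univ.sup lam))
    {u : Matrix (Fin k) (Fin k) ℂ} (hu : UT u) :
    (blockProj lam i)ᴴ * Gmap lam u = u * (blockProj lam i)ᴴ := by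
  ext a t
  rw [conjTranspose_blockProj_mul_apply, mul_conjTranspose_blockProj_apply]
  obtain ⟨j, d⟩ := t
  by_cases hij : i = j
  · subst hij
    by_cases ha : (a : ℕ) < conj' lam (i : ℕ)
    · simp [Gmap, ha]
    · simpa [ha] using (hu _ _ (Fin.lt_def.2 (lt_of_lt_of_le d.2 (not_lt.1 ha)))).symm
  · simp [Gmap, hij, Ne.symm hij]

lemma Gmap_mul (lam : Fin k → ℕ) (X : Matrix (Fin k) (Fin k) ℂ) {u : Matrix (Fin k) (Fin k) ℂ}
    (hu : UT u) : Gmap lam (X * u) = Gmap lam X * Gmap lam u := by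
  rw [Gmap_eq_cpMap lam X, Gmap_eq_cpMap lam (X * u), cpMap, cpMap, Finset.sum_mul]
  refine Finset.sum_congr rfl fun i _ => ?_
  rw [Matrix.mul_assoc _ _ (Gmap lam u), conjTranspose_blockProj_mul_Gmap lam i hu]
  simp only [Matrix.mul_assoc]

lemma Gmap_conjTranspose (lam : Fin k → ℕ) (X : Matrix (Fin k) (Fin k) ℂ) :
    (Gmap lam X)ᴴ = Gmap lam Xᴴ := by
  ext s t
  by_cases h : s.1 = t.1
  · simp [Gmap, h]
  · simp [Gmap, h, Ne.symm h]

lemma Gmap_sub (lam : Fin k → ℕ) (X Y : Matrix (Fin k) (Fin k) ℂ) :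
    Gmap lam (X - Y) = Gmap lam X - Gmap lam Y := by
  simp only [Gmap_eq_cpMap, cpMap_sub]

lemma Gmap_one (lam : Fin k → ℕ) : Gmap lam 1 = 1 := by
  ext ⟨i, a⟩ ⟨j, b⟩
  by_cases h : i = j
  · subst h
    simp [Gmap, one_apply, Fin.ext_iff]
  · simp [Gmap, one_apply, h]

lemma Gmap_conj (lam : Fin k → ℕ) (X : Matrix (Fin k) (Fin k) ℂ) {u : Matrix (Fin k) (Fin k) ℂ}
    (hu : UT u) :
    Gmap lam (uᴴ * X * u) = (Gmap lam u)ᴴ * Gmap lam X * Gmap lam u := by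
  have h := congrArg conjTranspose (Gmap_mul lam Xᴴ hu)
  rw [Gmap_conjTranspose, conjTranspose_mul, conjTranspose_conjTranspose, conjTranspose_mul,
    Gmap_conjTranspose lam Xᴴ, conjTranspose_conjTranspose] at h
  rw [Gmap_mul lam _ hu, h]

lemma isUnit_det_Gmap (lam : Fin k → ℕ) {u : Matrix (Fin k) (Fin k) ℂ} (hu : UT u)
    (h : IsUnit u.det) : IsUnit (Gmap lam u).det := by
  have := Gmap_mul lam u⁻¹ hu
  rw [nonsing_inv_mul u h, Gmap_one] at this
  have := congrArg det this
  rw [det_one, det_mul] at this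
  exact IsUnit.of_mul_eq_one_right _ this.symm

lemma lt_conj'_iff {lam : Fin k → ℕ} (hl : Antitone lam) (i : ℕ) (a : Fin k) :
    (a : ℕ) < conj' lam i ↔ i < lam a := by
  rw [conj']
  constructor
  · intro h
    by_contra hc
    have : (Finset.univ.filter fun j : Fin k => i < lam j) ⊆ Finset.Iio a := fun j hj => by
      rw [Finset.mem_Iio]
      by_contra hja
      exact hc ((Finset.mem_filter.1 hj).2.trans_le (hl (not_lt.1 hja)))
    have := Finset.card_le_card this
    rw [Fin.card_Iio] at this
    omega
  · intro h
    have : Finset.Iic a ⊆ (Finset.univ.filter fun j : Fin k => i < lam j) := fun j hj =>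
      Finset.mem_filter.2 ⟨Finset.mem_univ _, h.trans_le (hl (Finset.mem_Iic.1 hj))⟩
    have := Finset.card_le_card this
    rw [Fin.card_Iic] at this
    omega

lemma GmapAdj_one {lam : Fin k → ℕ} (hl : Antitone lam) :
    GmapAdj lam 1 = diagonal fun j => ((lam j : ℝ) : ℂ) := by
  ext a b
  by_cases hab : a = b
  · subst hab
    have hc : (Finset.univ.filter fun i : Fin (Finset.univ.sup lam) => (i : ℕ) < lam a).card
        = lam a := by
      rw [Fin.card_filter_val_lt]
      exact min_eq_right (Finset.le_sup (Finset.mem_univ a))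
    rw [diagonal_apply_eq, GmapAdj]
    simp only [and_self, one_apply_eq, dite_eq_ite, lt_conj'_iff hl, Finset.sum_boole, hc,
      Complex.ofReal_natCast]
  · rw [diagonal_apply_ne _ hab, GmapAdj]
    refine Finset.sum_eq_zero fun i _ => ?_
    split_ifs with h
    · refine one_apply_ne fun he => hab ?_
      simpa [Fin.ext_iff] using he
    · rfl

lemma GmapAdj_Gmap_mul_conjTranspose {lam : Fin k → ℕ} (hl : Antitone lam)
    {u : Matrix (Fin k) (Fin k) ℂ} (hu : UT u) :
    GmapAdj lam (Gmap lam u * (Gmap lam u)ᴴ) =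
      u * diagonal (fun j => ((lam j : ℝ) : ℂ)) * uᴴ := by
  rw [← GmapAdj_one hl, GmapAdj_eq_cpDual, GmapAdj_eq_cpDual, cpDual, cpDual, Finset.mul_sum,
    Finset.sum_mul]
  refine Finset.sum_congr rfl fun i _ => ?_
  have h := conjTranspose_blockProj_mul_Gmap lam i hu
  have h' := congrArg conjTranspose h
  rw [conjTranspose_mul, conjTranspose_mul, conjTranspose_conjTranspose] at h'
  rw [← Matrix.mul_assoc, h, Matrix.mul_assoc, h', Matrix.mul_one]
  simp only [Matrix.mul_assoc]

lemma posDef_of_Gmap_posDef {lam : Fin k → ℕ} (h0 : ∀ j, 0 < lam j)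
    {X : Matrix (Fin k) (Fin k) ℂ} (h : (Gmap lam X).PosDef) : X.PosDef := by
  have hc : conj' lam 0 = k := by simp [conj', h0]
  have hs : ∀ a : Fin k, 0 < Finset.univ.sup lam := fun a =>
    (h0 a).trans_le (Finset.le_sup (Finset.mem_univ a))
  let f : Fin k → lamIdx lam := fun a => ⟨⟨0, hs a⟩, Fin.cast hc.symm a⟩
  have hf : Function.Injective f := fun a b hab => by
    have := (Sigma.mk.inj_iff.1 hab).2
    simpa using this
  have := h.submatrix hf
  convert this using 1
  ext a b
  simp only [submatrix_apply, Gmap, f, if_true]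
  rfl

end Gadget

section Scaling

open scoped ComplexOrder

lemma near_inv_mul_conjTranspose {ι : Type*} [Fintype ι] [DecidableEq ι] {c : ℝ} (hc : 0 < c)
    {K g : Matrix ι ι ℂ} (hg : IsUnit g.det) (h : Near c (gᴴ * K * g) 1) :
    Near c K⁻¹ (g * gᴴ) := by
  have hM : (gᴴ * K * g).PosDef := h.symm.posDef hc PosDef.one
  have h1 := (h.inv hc hM PosDef.one).conj g
  have hgs : IsUnit gᴴ.det := by rw [det_conjTranspose]; exact hg.star
  rwa [inv_one, Matrix.mul_one, Matrix.mul_inv_rev, Matrix.mul_inv_rev, ← Matrix.mul_assoc, ← Matrix.mul_assoc,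
    mul_nonsing_inv g hg, Matrix.one_mul, Matrix.mul_assoc, nonsing_inv_mul _ hgs,
    Matrix.mul_one] at h1

lemma posDef_of_near_conj_one {ι : Type*} [Fintype ι] [DecidableEq ι] {c : ℝ} (hc : 0 < c)
    {K g : Matrix ι ι ℂ} (hg : IsUnit g.det) (h : Near c (gᴴ * K * g) 1) : K.PosDef :=
  (IsUnit.posDef_star_left_conjugate_iff ((isUnit_iff_isUnit_det g).2 hg)).1
    (h.symm.posDef hc PosDef.one)

lemma inv_eq_mul_conjTranspose {ι : Type*} [Fintype ι] [DecidableEq ι] {K U : Matrix ι ι ℂ}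
    (h : Uᴴ * K * U = 1) : K⁻¹ = U * Uᴴ := by
  refine inv_eq_left_inv ?_
  have := mul_eq_one_comm.1 h
  rwa [← Matrix.mul_assoc] at this

lemma UT.mul_diagonal {k : ℕ} {u : Matrix (Fin k) (Fin k) ℂ} (hu : UT u) (d : Fin k → ℂ) :
    UT (u * diagonal d) := fun i j hij => by
  rw [Matrix.mul_diagonal, hu i j hij, zero_mul]

/-- The positive square root of the diagonal matrix with entries `lam`. -/
def sqrtDiag {k : ℕ} (lam : Fin k → ℕ) : Matrix (Fin k) (Fin k) ℂ :=
  diagonal fun j => ((Real.sqrt (lam j) : ℝ) : ℂ)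

/-- The inverse of `sqrtDiag lam` when the entries of `lam` are positive. -/
def invSqrtDiag {k : ℕ} (lam : Fin k → ℕ) : Matrix (Fin k) (Fin k) ℂ :=
  diagonal fun j => (((Real.sqrt (lam j))⁻¹ : ℝ) : ℂ)

lemma sqrtDiag_conjTranspose {k : ℕ} (lam : Fin k → ℕ) : (sqrtDiag lam)ᴴ = sqrtDiag lam := by
  rw [sqrtDiag, diagonal_conjTranspose]
  congr 1
  ext j
  simp

lemma invSqrtDiag_conjTranspose {k : ℕ} (lam : Fin k → ℕ) :
    (invSqrtDiag lam)ᴴ = invSqrtDiag lam := by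
  rw [invSqrtDiag, diagonal_conjTranspose]
  congr 1
  ext j
  simp

lemma sqrtDiag_mul_self {k : ℕ} (lam : Fin k → ℕ) :
    sqrtDiag lam * sqrtDiag lam = diagonal fun j => ((lam j : ℝ) : ℂ) := by
  rw [sqrtDiag, diagonal_mul_diagonal]
  congr 1
  ext j
  rw [← Complex.ofReal_mul, Real.mul_self_sqrt (Nat.cast_nonneg _)]

lemma invSqrtDiag_mul_sqrtDiag {k : ℕ} {lam : Fin k → ℕ} (h0 : ∀ j, 0 < lam j) :
    invSqrtDiag lam * sqrtDiag lam = 1 := by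
  rw [invSqrtDiag, sqrtDiag, diagonal_mul_diagonal, ← diagonal_one]
  congr 1
  ext j
  have : Real.sqrt (lam j) ≠ 0 := (Real.sqrt_pos.2 (Nat.cast_pos.2 (h0 j))).ne'
  rw [← Complex.ofReal_mul, inv_mul_cancel₀ this, Complex.ofReal_one]

lemma isUnit_det_sqrtDiag {k : ℕ} {lam : Fin k → ℕ} (h0 : ∀ j, 0 < lam j) :
    IsUnit (sqrtDiag lam).det := by
  have := congrArg det (invSqrtDiag_mul_sqrtDiag h0)
  rw [det_mul, det_one] at this
  exact IsUnit.of_mul_eq_one_right _ this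

lemma isUnit_det_invSqrtDiag {k : ℕ} {lam : Fin k → ℕ} (h0 : ∀ j, 0 < lam j) :
    IsUnit (invSqrtDiag lam).det := by
  have := congrArg det (invSqrtDiag_mul_sqrtDiag h0)
  rw [det_mul, det_one] at this
  exact IsUnit.of_mul_eq_one _ this

lemma invSqrtDiag_conj_diagonal {k : ℕ} {lam : Fin k → ℕ} (h0 : ∀ j, 0 < lam j) :
    invSqrtDiag lam * (diagonal fun j => ((lam j : ℝ) : ℂ)) * invSqrtDiag lam = 1 := by
  have h := invSqrtDiag_mul_sqrtDiag h0
  rw [← sqrtDiag_mul_self, ← Matrix.mul_assoc, h, Matrix.one_mul, mul_eq_one_comm, h]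

lemma mul_sqrtDiag_mul_conjTranspose {k : ℕ} (lam : Fin k → ℕ) (u : Matrix (Fin k) (Fin k) ℂ) :
    u * sqrtDiag lam * (u * sqrtDiag lam)ᴴ =
      u * diagonal (fun j => ((lam j : ℝ) : ℂ)) * uᴴ := by
  rw [conjTranspose_mul, sqrtDiag_conjTranspose, ← sqrtDiag_mul_self]
  simp only [Matrix.mul_assoc]

lemma conj_mul_sqrtDiag {k : ℕ} (lam : Fin k → ℕ) {u Z : Matrix (Fin k) (Fin k) ℂ}
    (h : uᴴ * Z * u = 1) :
    (u * sqrtDiag lam)ᴴ * Z * (u * sqrtDiag lam) = diagonal fun j => ((lam j : ℝ) : ℂ) := by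
  have : (u * sqrtDiag lam)ᴴ * Z * (u * sqrtDiag lam) =
      sqrtDiag lam * (uᴴ * Z * u) * sqrtDiag lam := by
    rw [conjTranspose_mul, sqrtDiag_conjTranspose]
    simp only [Matrix.mul_assoc]
  rw [this, h, Matrix.mul_one, sqrtDiag_mul_self]

/-- The lift of `g` to the gadget space used to turn the marginal `diag lam` into the identity. -/
def gadgetLift {k : ℕ} (lam : Fin k → ℕ) (g : Matrix (Fin k) (Fin k) ℂ) :
    Matrix (lamIdx lam) (lamIdx lam) ℂ :=
  Gmap lam (g * invSqrtDiag lam)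

lemma isUnit_det_gadgetLift {k : ℕ} {lam : Fin k → ℕ} (h0 : ∀ j, 0 < lam j)
    {g : Matrix (Fin k) (Fin k) ℂ} (hg : UT g) (hgu : IsUnit g.det) :
    IsUnit (gadgetLift lam g).det := by
  refine isUnit_det_Gmap lam (hg.mul_diagonal _) ?_
  rw [det_mul]
  exact hgu.mul (isUnit_det_invSqrtDiag h0)

lemma GmapAdj_gadgetLift {k : ℕ} {lam : Fin k → ℕ} (hl : Antitone lam) (h0 : ∀ j, 0 < lam j)
    {g : Matrix (Fin k) (Fin k) ℂ} (hg : UT g) :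
    GmapAdj lam (gadgetLift lam g * (gadgetLift lam g)ᴴ) = g * gᴴ := by
  have hgR : UT (g * invSqrtDiag lam) := hg.mul_diagonal _
  rw [gadgetLift, GmapAdj_Gmap_mul_conjTranspose hl hgR, conjTranspose_mul,
    invSqrtDiag_conjTranspose]
  have := invSqrtDiag_conj_diagonal h0
  calc _ = g * (invSqrtDiag lam * (diagonal fun j => ((lam j : ℝ) : ℂ)) * invSqrtDiag lam) * gᴴ := by
        simp only [Matrix.mul_assoc]
    _ = g * gᴴ := by rw [this, Matrix.mul_one]

lemma frob_gadgetLift_conj_sub_one_le {k : ℕ} {lam : Fin k → ℕ} (h0 : ∀ j, 0 < lam j)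
    {g M : Matrix (Fin k) (Fin k) ℂ} (hg : UT g) (hM : M.PosSemidef) {δ : ℝ}
    (h : frob (gᴴ * M * g - diagonal fun j => ((lam j : ℝ) : ℂ)) ≤ δ) :
    frob ((gadgetLift lam g)ᴴ * Gmap lam M * gadgetLift lam g - 1) ≤
      δ * frob (cpMap (fun i => blockProj lam i * invSqrtDiag lam) 1) := by
  have hD : (diagonal fun j => ((lam j : ℝ) : ℂ)).IsHermitian := by
    rw [← sqrtDiag_mul_self, IsHermitian, conjTranspose_mul, sqrtDiag_conjTranspose]
  have hgR : UT (g * invSqrtDiag lam) := hg.mul_diagonal _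
  refine le_of_eq_of_le (congrArg frob ?_)
    (frob_cpMap_le _ ((hM.conjTranspose_mul_mul_same g).isHermitian.sub hD) h)
  rw [gadgetLift, ← Gmap_conj lam M hgR, ← Gmap_one lam,
    ← invSqrtDiag_conj_diagonal h0, ← Gmap_sub, Gmap_eq_cpMap, conjTranspose_mul,
    invSqrtDiag_conjTranspose]
  simp only [cpMap, conjTranspose_mul, invSqrtDiag_conjTranspose, Matrix.mul_assoc, Matrix.mul_sub,
    Matrix.sub_mul]

/-- If `Gmap lam Z` is nearly scaled to the identity by `g`, then an upper triangular `u` scaling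
`Z` to the identity lifts to `U` with `U Uᴴ` near `g gᴴ`. -/
lemma exists_upperTriangular_near {k : ℕ} {lam : Fin k → ℕ} (h0 : ∀ j, 0 < lam j) {c : ℝ}
    {Z : Matrix (Fin k) (Fin k) ℂ} (hZ : (Gmap lam Z).PosDef)
    {Y : Matrix (lamIdx lam) (lamIdx lam) ℂ} (h : Near c (Gmap lam Z)⁻¹ Y) :
    ∃ u : Matrix (Fin k) (Fin k) ℂ, UT u ∧ IsUnit u.det ∧ uᴴ * Z * u = 1 ∧
      Near c (Gmap lam u * (Gmap lam u)ᴴ) Y := by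
  obtain ⟨u, hu, hud, huZ⟩ := exists_upperTriangular_conj_eq_one (posDef_of_Gmap_posDef h0 hZ)
  refine ⟨u, hu, hud, huZ, ?_⟩
  rwa [← inv_eq_mul_conjTranspose (K := Gmap lam Z)]
  rw [← Gmap_conj lam Z hu, huZ, Gmap_one]

lemma Near.Gmap {k : ℕ} {lam : Fin k → ℕ} {c : ℝ} {X Y : Matrix (Fin k) (Fin k) ℂ}
    (h : Near c X Y) : Near c (Gmap lam X) (Gmap lam Y) := by
  rw [Gmap_eq_cpMap, Gmap_eq_cpMap]
  exact h.cpMap _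

lemma Near.GmapAdj {k : ℕ} {lam : Fin k → ℕ} {c : ℝ} {X Y : Matrix (lamIdx lam) (lamIdx lam) ℂ}
    (h : Near c X Y) : Near c (GmapAdj lam X) (GmapAdj lam Y) := by
  rw [GmapAdj_eq_cpDual, GmapAdj_eq_cpDual]
  exact h.cpDual _

lemma Gmap_posSemidef {k : ℕ} {lam : Fin k → ℕ} {X : Matrix (Fin k) (Fin k) ℂ}
    (h : X.PosSemidef) : (Gmap lam X).PosSemidef :=
  Gmap_eq_cpMap lam X ▸ cpMap_posSemidef _ h

lemma GmapAdj_posSemidef {k : ℕ} {lam : Fin k → ℕ} {X : Matrix (lamIdx lam) (lamIdx lam) ℂ}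
    (h : X.PosSemidef) : (GmapAdj lam X).PosSemidef :=
  GmapAdj_eq_cpDual lam X ▸ cpDual_posSemidef _ h

lemma exists_upperTriangular_scaling {n m r : ℕ} (A : Fin r → Matrix (Fin m) (Fin n) ℂ)
    (p : Fin n → ℕ) (q : Fin m → ℕ)
    (hp : Antitone p) (hp0 : ∀ j, 0 < p j) (hq : Antitone q) (hq0 : ∀ i, 0 < q i)
    {t : ℝ} (ht : 0 < t) {g : Matrix (lamIdx q) (lamIdx q) ℂ} {h : Matrix (lamIdx p) (lamIdx p) ℂ}
    (hg : IsUnit g.det) (hh : IsUnit h.det)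
    (hgT : frob (gᴴ * trun A p q (h * hᴴ) * g - 1) ≤ t / (1 + t))
    (hhT : frob (hᴴ * trunDual A p q (g * gᴴ) * h - 1) ≤ t / (1 + t)) :
    ∃ (g₀ : Matrix (Fin m) (Fin m) ℂ) (h₀ : Matrix (Fin n) (Fin n) ℂ),
      IsUnit g₀.det ∧ UT g₀ ∧ IsUnit h₀.det ∧ UT h₀ ∧
      Near ((1 + t) * (1 + t)) (g₀ᴴ * cpMap A (h₀ * h₀ᴴ) * g₀)
        (diagonal fun i => ((q i : ℝ) : ℂ)) ∧
      h₀ᴴ * cpDual A (g₀ * g₀ᴴ) * h₀ = diagonal fun j => ((p j : ℝ) : ℂ) := by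
  have hc : 0 < 1 + t := by linarith
  have hK : (trun A p q (h * hᴴ)).PosSemidef :=
    Gmap_posSemidef (cpMap_posSemidef A (GmapAdj_posSemidef (posSemidef_self_mul_conjTranspose h)))
  have hL : (trunDual A p q (g * gᴴ)).PosSemidef :=
    Gmap_posSemidef (cpDual_posSemidef A (GmapAdj_posSemidef (posSemidef_self_mul_conjTranspose g)))
  have hgN := near_one_of_frob_le (hK.conjTranspose_mul_mul_same g).isHermitian ht hgT
  have hhN := near_one_of_frob_le (hL.conjTranspose_mul_mul_same h).isHermitian ht hhT
  have hKd := posDef_of_near_conj_one hc hg hgN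
  have hLd := posDef_of_near_conj_one hc hh hhN
  obtain ⟨u, hu, hud, huZ, huN⟩ :=
    exists_upperTriangular_near hq0 hKd (near_inv_mul_conjTranspose hc hg hgN)
  have hLN := (huN.GmapAdj.cpDual A).Gmap (lam := p)
  rw [GmapAdj_Gmap_mul_conjTranspose hq hu, ← mul_sqrtDiag_mul_conjTranspose] at hLN
  have hWd := hLN.symm.posDef hc hLd
  obtain ⟨v, hv, hvd, hvW, hvN⟩ := exists_upperTriangular_near hp0 hWd
    ((hLN.inv hc hWd hLd).trans hc.le hc.le (near_inv_mul_conjTranspose hc hh hhN))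
  have hZN := ((hvN.GmapAdj.cpMap A).conj (u * sqrtDiag q)ᴴ)
  rw [GmapAdj_Gmap_mul_conjTranspose hp hv, ← mul_sqrtDiag_mul_conjTranspose,
    conjTranspose_conjTranspose, conj_mul_sqrtDiag q huZ] at hZN
  refine ⟨u * sqrtDiag q, v * sqrtDiag p, ?_, hu.mul_diagonal _, ?_, hv.mul_diagonal _, hZN,
    conj_mul_sqrtDiag p hvW⟩
  · rw [det_mul]
    exact hud.mul (isUnit_det_sqrtDiag hq0)
  · rw [det_mul]
    exact hvd.mul (isUnit_det_sqrtDiag hp0)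

lemma scalable_of_trun_scalable {n m r : ℕ} (A : Fin r → Matrix (Fin m) (Fin n) ℂ)
    (p : Fin n → ℕ) (q : Fin m → ℕ)
    (hp : Antitone p) (hp0 : ∀ j, 0 < p j) (hq : Antitone q) (hq0 : ∀ i, 0 < q i) :
    (∀ ε : ℝ, 0 < ε →
      ∃ (g : Matrix (lamIdx q) (lamIdx q) ℂ) (h : Matrix (lamIdx p) (lamIdx p) ℂ),
        IsUnit g.det ∧ IsUnit h.det ∧
        frob (gᴴ * trun A p q (h * hᴴ) * g - 1) ≤ ε ∧
        frob (hᴴ * trunDual A p q (g * gᴴ) * h - 1) ≤ ε) →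
    (∀ ε : ℝ, 0 < ε →
      ∃ (g : Matrix (Fin m) (Fin m) ℂ) (h : Matrix (Fin n) (Fin n) ℂ),
        IsUnit g.det ∧ UT g ∧ IsUnit h.det ∧ UT h ∧
        frob (gᴴ * cpMap A (h * hᴴ) * g - Matrix.diagonal (fun i => ((q i : ℝ) : ℂ))) ≤ ε ∧
        frob (hᴴ * cpDual A (g * gᴴ) * h - Matrix.diagonal (fun j => ((p j : ℝ) : ℂ))) ≤ ε) := by
  intro H ε hε
  set S := frob (diagonal fun i => ((q i : ℝ) : ℂ)) with hS
  have hS0 : 0 ≤ S := frob_nonneg _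
  set t := min 1 (ε / (3 * (1 + S))) with ht_def
  have ht : 0 < t := lt_min one_pos (by positivity)
  have ht1 : t ≤ 1 := min_le_left _ _
  have ht2 : t * (3 * (1 + S)) ≤ ε := (le_div_iff₀ (by positivity)).1 (min_le_right _ _)
  obtain ⟨g, h, hg, hh, hgT, hhT⟩ := H (t / (1 + t)) (by positivity)
  obtain ⟨g₀, h₀, hg₀, hgU, hh₀, hhU, hN, hP⟩ :=
    exists_upperTriangular_scaling A p q hp hp0 hq hq0 ht hg hh hgT hhT
  refine ⟨g₀, h₀, hg₀, hgU, hh₀, hhU, ?_, ?_⟩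
  · have hD : (diagonal fun i => ((q i : ℝ) : ℂ)).PosSemidef := by
      have := posSemidef_self_mul_conjTranspose (sqrtDiag q)
      rwa [sqrtDiag_conjTranspose, sqrtDiag_mul_self] at this
    refine (frob_sub_le_of_near (by nlinarith) hD hN).trans ?_
    rw [← hS]
    nlinarith [mul_nonneg ht.le hS0, mul_nonneg (mul_nonneg ht.le hS0) (sub_nonneg.2 ht1)]
  · rw [hP, sub_self]
    simpa [frob] using hε.le

lemma trun_scalable_of_scalable {n m r : ℕ} (A : Fin r → Matrix (Fin m) (Fin n) ℂ)
    (p : Fin n → ℕ) (q : Fin m → ℕ)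
    (hp : Antitone p) (hp0 : ∀ j, 0 < p j) (hq : Antitone q) (hq0 : ∀ i, 0 < q i) :
    (∀ ε : ℝ, 0 < ε →
      ∃ (g : Matrix (Fin m) (Fin m) ℂ) (h : Matrix (Fin n) (Fin n) ℂ),
        IsUnit g.det ∧ UT g ∧ IsUnit h.det ∧ UT h ∧
        frob (gᴴ * cpMap A (h * hᴴ) * g - Matrix.diagonal (fun i => ((q i : ℝ) : ℂ))) ≤ ε ∧
        frob (hᴴ * cpDual A (g * gᴴ) * h - Matrix.diagonal (fun j => ((p j : ℝ) : ℂ))) ≤ ε) →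
    (∀ ε : ℝ, 0 < ε →
      ∃ (g : Matrix (lamIdx q) (lamIdx q) ℂ) (h : Matrix (lamIdx p) (lamIdx p) ℂ),
        IsUnit g.det ∧ IsUnit h.det ∧
        frob (gᴴ * trun A p q (h * hᴴ) * g - 1) ≤ ε ∧
        frob (hᴴ * trunDual A p q (g * gᴴ) * h - 1) ≤ ε) := by
  intro H ε hε
  set a := frob (cpMap (fun i => blockProj q i * invSqrtDiag q) 1)
  set b := frob (cpMap (fun i => blockProj p i * invSqrtDiag p) 1)
  have ha : 0 ≤ a := frob_nonneg _
  have hb : 0 ≤ b := frob_nonneg _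
  have hδ : 0 < ε / (1 + a + b) := by positivity
  have hmul : ε / (1 + a + b) * (1 + a + b) = ε := div_mul_cancel₀ _ (by positivity)
  obtain ⟨g, h, hg, hgU, hh, hhU, hgT, hhT⟩ := H (ε / (1 + a + b)) hδ
  refine ⟨gadgetLift q g, gadgetLift p h, isUnit_det_gadgetLift hq0 hgU hg,
    isUnit_det_gadgetLift hp0 hhU hh, ?_, ?_⟩
  · rw [trun, GmapAdj_gadgetLift hp hp0 hhU]
    refine (frob_gadgetLift_conj_sub_one_le hq0 hgU
      (cpMap_posSemidef A (posSemidef_self_mul_conjTranspose h)) hgT).trans ?_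
    nlinarith [mul_nonneg hδ.le hb]
  · rw [trunDual, GmapAdj_gadgetLift hq hq0 hgU]
    refine (frob_gadgetLift_conj_sub_one_le hp0 hhU
      (cpDual_posSemidef A (posSemidef_self_mul_conjTranspose g)) hhT).trans ?_
    nlinarith [mul_nonneg hδ.le ha]

end Scaling

/-- Theorem: for integral marginals, `trun_{P,Q} T` is approximately scalable to doubly
stochastic by invertible matrices iff `T` is approximately scalable by invertible
upper-triangular matrices to `(I_n → Q, I_m → P)`. -/
theorem stmt2 {n m r N : ℕ} (A : Fin r → Matrix (Fin m) (Fin n) ℂ)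
    (p : Fin n → ℕ) (q : Fin m → ℕ)
    (hp : Antitone p) (hp0 : ∀ j, 0 < p j) (hq : Antitone q) (hq0 : ∀ i, 0 < q i)
    (hpN : ∑ j, p j = N) (hqN : ∑ i, q i = N) :
    (∀ ε : ℝ, 0 < ε →
      ∃ (g : Matrix (lamIdx q) (lamIdx q) ℂ) (h : Matrix (lamIdx p) (lamIdx p) ℂ),
        IsUnit g.det ∧ IsUnit h.det ∧
        frob (gᴴ * trun A p q (h * hᴴ) * g - 1) ≤ ε ∧
        frob (hᴴ * trunDual A p q (g * gᴴ) * h - 1) ≤ ε)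
    ↔
    (∀ ε : ℝ, 0 < ε →
      ∃ (g : Matrix (Fin m) (Fin m) ℂ) (h : Matrix (Fin n) (Fin n) ℂ),
        IsUnit g.det ∧ UT g ∧ IsUnit h.det ∧ UT h ∧
        frob (gᴴ * cpMap A (h * hᴴ) * g - Matrix.diagonal (fun i => ((q i : ℝ) : ℂ))) ≤ ε ∧
        frob (hᴴ * cpDual A (g * gᴴ) * h - Matrix.diagonal (fun j => ((p j : ℝ) : ℂ))) ≤ ε) := by
  exact ⟨scalable_of_trun_scalable A p q hp hp0 hq hq0,
    trun_scalable_of_scalable A p q hp hp0 hq hq0⟩
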